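/- Let S ⊆ T be a tree extension, M a representation of T over a field K, and B an ordered basis of M that is ordered above S. Let β ⊆ B and β_S = β ∩ B_S. If the Schubert cell C_β^M is nonempty, then there exists an integer n_β ≥ 0 and a bijection C_β^M → C_{β_S}^{M_S} × K^{n_β} whose first component is the map sending a subrepresentation V of M to its restriction (V_p)_{p ∈ S0} to S. -/

import Mathlib

open scoped Classical

noncomputable section

namespace QGr

/-- A representation of the quiver with vertex set `V0` and arrow set `A`
(source and target maps are part of the data), given in coordinates with respect to
an ordered basis `B`: the basis element `b : B` sits at the vertex `vtx b`, the space
at the vertex `p` is `{b : B // vtx b = p} → K`, and `mmap a` is the map attached to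
the arrow `a`. -/
structure Rep (K : Type) [Field K] (V0 A B : Type) where
  src : A → V0
  tgt : A → V0
  vtx : B → V0
  mmap : ∀ a : A, ({b : B // vtx b = src a} → K) → ({b : B // vtx b = tgt a} → K)

namespace Rep

variable {K : Type} [Field K] {V0 A B : Type}

/-- A collection of subspaces, one at each vertex. -/
def SubRep (R : Rep K V0 A B) : Type :=
  ∀ p : V0, Submodule K ({b : B // R.vtx b = p} → K)

/-- The collection `W` is a subrepresentation. -/
def IsSubrep (R : Rep K V0 A B) (W : R.SubRep) : Prop :=
  ∀ a : A, ∀ x ∈ W (R.src a), R.mmap a x ∈ W (R.tgt a)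

/-- All structure maps are `K`-linear. -/
def Linear (R : Rep K V0 A B) : Prop := ∀ a : A, IsLinearMap K (R.mmap a)

/-- Membership in the Schubert cell attached to `β ⊆ B`: each `W p` is spanned by vectors
`v b₀ = b₀ + ∑ λ_{b',b₀} b'` (`b₀ ∈ β ∩ B_p`), the sum over `b' < b₀` with `b' ∉ β`. -/
def InCell [LinearOrder B] (R : Rep K V0 A B) (β : Finset B) (W : R.SubRep) : Prop :=
  ∀ p : V0, ∃ v : {b : B // b ∈ β ∧ R.vtx b = p} → ({b : B // R.vtx b = p} → K),
    (∀ b0, v b0 ⟨b0.val, b0.prop.2⟩ = 1) ∧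
    (∀ b0 b1, b1.val ≠ b0.val → ¬(b1.val < b0.val ∧ b1.val ∉ β) → v b0 b1 = 0) ∧
    W p = Submodule.span K (Set.range v)

/-- The Schubert cell `C_β^M`. -/
def Cell [LinearOrder B] (R : Rep K V0 A B) (β : Finset B) : Set R.SubRep :=
  {W | R.IsSubrep W ∧
    (∀ p : V0, Module.finrank K (W p) = (β.filter fun b => R.vtx b = p).card) ∧
    R.InCell β W}

/-- The quiver Grassmannian `Gr_e(M)`. -/
def Gr (R : Rep K V0 A B) (e : V0 → ℕ) : Set R.SubRep :=
  {W | R.IsSubrep W ∧ ∀ p : V0, Module.finrank K (W p) = e p}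

/-- Collections of subspaces indexed by the vertices in `S0`. -/
def SubRepOn (R : Rep K V0 A B) (S0 : Set V0) : Type :=
  ∀ p : {p : V0 // p ∈ S0}, Submodule K ({b : B // R.vtx b = ↑p} → K)

/-- Subrepresentation condition over the subquiver `(S0, S1)`. -/
def IsSubrepOn (R : Rep K V0 A B) (S0 : Set V0) (S1 : Set A) (W : R.SubRepOn S0) : Prop :=
  ∀ a : A, a ∈ S1 → ∀ (h1 : R.src a ∈ S0) (h2 : R.tgt a ∈ S0),
    ∀ x ∈ W ⟨R.src a, h1⟩, R.mmap a x ∈ W ⟨R.tgt a, h2⟩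

/-- Cell membership over the vertices in `S0`. -/
def InCellOn [LinearOrder B] (R : Rep K V0 A B) (S0 : Set V0) (β : Finset B)
    (W : R.SubRepOn S0) : Prop :=
  ∀ p : {p : V0 // p ∈ S0},
    ∃ v : {b : B // b ∈ β ∧ R.vtx b = ↑p} → ({b : B // R.vtx b = ↑p} → K),
      (∀ b0, v b0 ⟨b0.val, b0.prop.2⟩ = 1) ∧
      (∀ b0 b1, b1.val ≠ b0.val → ¬(b1.val < b0.val ∧ b1.val ∉ β) → v b0 b1 = 0) ∧
      W p = Submodule.span K (Set.range v)

/-- The Schubert cell of the restriction of the representation to the subquiver `(S0, S1)`. -/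
def CellOn [LinearOrder B] (R : Rep K V0 A B) (S0 : Set V0) (S1 : Set A) (β : Finset B) :
    Set (R.SubRepOn S0) :=
  {W | R.IsSubrepOn S0 S1 W ∧
    (∀ p : {p : V0 // p ∈ S0},
      Module.finrank K (W p) = (β.filter fun b => R.vtx b = ↑p).card) ∧
    R.InCellOn S0 β W}

/-- The quiver Grassmannian of the restriction to the subquiver `(S0, S1)`. -/
def GrOn (R : Rep K V0 A B) (S0 : Set V0) (S1 : Set A) (e : V0 → ℕ) :
    Set (R.SubRepOn S0) :=
  {W | R.IsSubrepOn S0 S1 W ∧ ∀ p : {p : V0 // p ∈ S0}, Module.finrank K (W p) = e ↑p}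

/-- Restriction of a collection of subspaces to the vertices in `S0`. -/
def resOn (R : Rep K V0 A B) (S0 : Set V0) (W : R.SubRep) : R.SubRepOn S0 :=
  fun p => W ↑p

/-- `p < q` for vertices: every basis element at `p` precedes every basis element at `q`. -/
def vlt [LT B] (R : Rep K V0 A B) (p q : V0) : Prop :=
  ∀ b b' : B, R.vtx b = p → R.vtx b' = q → b < b'

def vle [LT B] (R : Rep K V0 A B) (p q : V0) : Prop := p = q ∨ R.vlt p q

/-- The matrix of `mmap a` with respect to the ordered bases at source and target is a
(square) identity matrix. -/
def IsIdMat [LinearOrder B] (R : Rep K V0 A B) (a : A) : Prop :=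
  ∃ e : {b : B // R.vtx b = R.src a} ≃o {b : B // R.vtx b = R.tgt a},
    ∀ i, R.mmap a (Pi.single i 1) = Pi.single (e i) 1

/-- `mmap a` sends the basis vector `b0` to the basis vector `b1`. -/
def MapsBasisTo (R : Rep K V0 A B) (a : A) (b0 b1 : B) : Prop :=
  ∃ (h0 : R.vtx b0 = R.src a) (h1 : R.vtx b1 = R.tgt a),
    R.mmap a (Pi.single ⟨b0, h0⟩ 1) = Pi.single ⟨b1, h1⟩ 1

/-- The ordered basis `B` is ordered above the subquiver `(S0, S1)`. -/
def OrderedAbove [LinearOrder B] (R : Rep K V0 A B) (S0 : Set V0) (S1 : Set A) : Prop :=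
  (∀ b b' : B, R.vtx b ∈ S0 → R.vtx b' ∉ S0 → b < b') ∧
  (∀ p q : V0, p ≠ q → R.vlt p q ∨ R.vlt q p) ∧
  (∀ (r : ℕ) (pa : Fin (r+1) → V0), pa 0 ∈ S0 → (∀ i, i ≠ 0 → pa i ∉ S0) →
    Function.Injective pa →
    (∀ i : Fin r, ∃ a : A, (R.src a = pa i.castSucc ∧ R.tgt a = pa i.succ) ∨
      (R.src a = pa i.succ ∧ R.tgt a = pa i.castSucc)) →
    ∀ i : Fin r, R.vlt (pa i.castSucc) (pa i.succ)) ∧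
  (∀ a : A, a ∉ S1 → R.IsIdMat a)

end Rep

/-- The relation on the vertices of the subquiver with vertex set `T0` identifying all
vertices of `S0` with each other. -/
def treeRel {V0 : Type} (S0 T0 : Set V0) :
    {v : V0 // v ∈ T0} → {v : V0 // v ∈ T0} → Prop :=
  fun x y => (↑x ∈ S0 ∧ ↑y ∈ S0)

/-- The subquiver `(T0, T1)` is a tree extension of the subquiver `(S0, S1)`:
the quotient quiver `T/S` (arrows of `T` not in `S`; vertices of `T` with all vertices of `S`
identified) is a tree, i.e. it is connected (as an undirected graph) and the number of its
edges is one less than the number of its vertices. -/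
def IsTreeExtensionIn {V0 A : Type} (src tgt : A → V0) (T0 : Set V0) (T1 : Set A)
    (S0 : Set V0) (S1 : Set A) : Prop :=
  (∀ u v : Quot (treeRel S0 T0), Relation.ReflTransGen (fun u v =>
      ∃ a : A, a ∈ T1 ∧ a ∉ S1 ∧ ∃ (hs : src a ∈ T0) (ht : tgt a ∈ T0),
        (Quot.mk (treeRel S0 T0) ⟨src a, hs⟩ = u ∧ Quot.mk (treeRel S0 T0) ⟨tgt a, ht⟩ = v) ∨
        (Quot.mk (treeRel S0 T0) ⟨src a, hs⟩ = v ∧ Quot.mk (treeRel S0 T0) ⟨tgt a, ht⟩ = u))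
      u v) ∧
  Nat.card {a : A // a ∈ T1 ∧ a ∉ S1} + 1 = Nat.card (Quot (treeRel S0 T0))

/-- `T` (the full ambient quiver) is a tree extension of the subquiver `(S0, S1)`. -/
def IsTreeExtension {V0 A : Type} (src tgt : A → V0) (S0 : Set V0) (S1 : Set A) : Prop :=
  IsTreeExtensionIn src tgt Set.univ Set.univ S0 S1

namespace Rep

variable {K : Type} [Field K] {V0 A B QV QA : Type}

/-- The structure map of the push-forward representation `F_*M` attached to the arrow `aq`
of the target quiver. -/
def pushMap [Fintype A] (R : Rep K V0 A B) (qsrc qtgt : QA → QV) (Fv : V0 → QV)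
    (Fa : A → QA) (hFs : ∀ a : A, Fv (R.src a) = qsrc (Fa a)) (aq : QA)
    (x : {b : B // Fv (R.vtx b) = qsrc aq} → K) (c : {b : B // Fv (R.vtx b) = qtgt aq}) : K :=
  ∑ α : A, if hα : Fa α = aq then
    (if hc : R.vtx c.val = R.tgt α then
      R.mmap α (fun b => x ⟨b.val, by rw [b.prop, hFs α, hα]⟩) ⟨c.val, hc⟩
    else 0) else 0

/-- The push-forward representation `F_*M` along the quiver morphism `F = (Fv, Fa)`. -/
def push [Fintype A] (R : Rep K V0 A B) (qsrc qtgt : QA → QV) (Fv : V0 → QV)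
    (Fa : A → QA) (hFs : ∀ a : A, Fv (R.src a) = qsrc (Fa a)) : Rep K QV QA B where
  src := qsrc
  tgt := qtgt
  vtx := fun b => Fv (R.vtx b)
  mmap := R.pushMap qsrc qtgt Fv Fa hFs

/-- The push-forward `F_*V` of a collection of subspaces: at the vertex `q` of `Q` it consists
of all vectors whose component in each `M_p` with `Fv p = q` lies in `V_p`. -/
def pushSub (R : Rep K V0 A B) (Fv : V0 → QV) (W : R.SubRep) :
    ∀ q : QV, Submodule K ({b : B // Fv (R.vtx b) = q} → K) := fun q =>
  { carrier := {x | ∀ (p : V0) (hq : Fv p = q),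
      (fun b : {b : B // R.vtx b = p} =>
        x ⟨b.val, by rw [b.prop]; exact hq⟩) ∈ W p}
    add_mem' := fun hx hy p hq => (W p).add_mem (hx p hq) (hy p hq)
    zero_mem' := fun p hq => (W p).zero_mem
    smul_mem' := fun c x hx p hq => (W p).smul_mem c (hx p hq) }

/-- `reach n p` : there is an (undirected) walk of length `n` from `p` into `S0`. -/
def reach (R : Rep K V0 A B) (S0 : Set V0) : ℕ → V0 → Prop
  | 0, p => p ∈ S0
  | (n+1), p => ∃ a : A, (R.src a = p ∧ R.reach S0 n (R.tgt a)) ∨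
      (R.tgt a = p ∧ R.reach S0 n (R.src a))

/-- The graph distance from `p` to the vertex set `S0`. -/
def distS (R : Rep K V0 A B) (S0 : Set V0) (p : V0) : ℕ :=
  sInf {n : ℕ | R.reach S0 n p}

/-- The fibre length `ε(p,p')` of a pair of vertices. -/
def eps [LT B] (R : Rep K V0 A B) (Fv : V0 → QV) (p p' : V0) : ℕ :=
  Set.ncard {p'' : V0 | Fv p'' = Fv p ∧ R.vle p p'' ∧ R.vlt p'' p'}

/-- Lexicographic comparison `Ψ(p,p') < Ψ(q,q')`. -/
def psiLt [LT B] (R : Rep K V0 A B) (S0 : Set V0) (Fv : V0 → QV) (p p' q q' : V0) : Prop :=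
  R.eps Fv p p' < R.eps Fv q q' ∨ (R.eps Fv p p' = R.eps Fv q q' ∧
    (max (R.distS S0 p) (R.distS S0 p') < max (R.distS S0 q) (R.distS S0 q') ∨
     (max (R.distS S0 p) (R.distS S0 p') = max (R.distS S0 q) (R.distS S0 q') ∧
       R.vlt p' q')))

def type0 [LT B] (R : Rep K V0 A B) (Fa : A → QA) (aq : QA) (t s : V0) : Prop :=
  ¬ ∃ α : A, Fa α = aq ∧ R.vle (R.src α) s ∧ R.vle t (R.tgt α)

def type1 (R : Rep K V0 A B) (Fa : A → QA) (aq : QA) (t s : V0) : Prop :=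
  ∃ α : A, Fa α = aq ∧ R.src α = s ∧ R.tgt α = t

def type2a [LT B] (R : Rep K V0 A B) (S0 : Set V0) (Fv : V0 → QV) (Fa : A → QA)
    (aq : QA) (t s : V0) : Prop :=
  ∃ α' α'' : A, Fa α' = aq ∧ Fa α'' = aq ∧ R.tgt α' = t ∧ R.vlt (R.src α') s ∧
    R.src α'' = s ∧ R.vlt (R.tgt α'') t ∧ R.psiLt S0 Fv t (R.tgt α'') (R.src α') s

def type2b [LT B] (R : Rep K V0 A B) (S0 : Set V0) (Fv : V0 → QV) (Fa : A → QA)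
    (aq : QA) (t s : V0) : Prop :=
  ∃ α' α'' : A, Fa α' = aq ∧ Fa α'' = aq ∧ R.tgt α' = t ∧ R.vlt (R.src α') s ∧
    R.src α'' = s ∧ R.vlt (R.tgt α'') t ∧ R.psiLt S0 Fv (R.src α') s t (R.tgt α'')

def type3a [LT B] (R : Rep K V0 A B) (S0 : Set V0) (Fv : V0 → QV) (Fa : A → QA)
    (aq : QA) (t s : V0) : Prop :=
  ∃ α'' : A, Fa α'' = aq ∧ R.src α'' = s ∧ R.vlt t (R.tgt α'') ∧
    (¬ ∃ α : A, Fa α = aq ∧ R.tgt α = t) ∧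
    ∀ α : A, Fa α = aq → R.vlt t (R.tgt α) → R.vlt (R.tgt α) (R.tgt α'') →
      R.psiLt S0 Fv (R.src α) s t (R.tgt α'')

def type4a [LT B] (R : Rep K V0 A B) (S0 : Set V0) (Fv : V0 → QV) (Fa : A → QA)
    (aq : QA) (t s : V0) : Prop :=
  ∃ α' : A, Fa α' = aq ∧ R.tgt α' = t ∧ R.vlt (R.src α') s ∧
    (¬ ∃ α : A, Fa α = aq ∧ R.src α = s) ∧
    ∀ α : A, Fa α = aq → R.vlt (R.src α') (R.src α) → R.vlt (R.src α) s →
      R.psiLt S0 Fv t (R.tgt α) (R.src α') s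

/-- `F` is strictly ordered with respect to the ordered basis. -/
def StrictlyOrdered [LT B] (R : Rep K V0 A B) (Fa : A → QA) : Prop :=
  ∀ α α' : A, α ≠ α' → Fa α = Fa α' →
    (R.vlt (R.src α) (R.src α') ∧ R.vlt (R.tgt α) (R.tgt α')) ∨
    (R.vlt (R.src α') (R.src α) ∧ R.vlt (R.tgt α') (R.tgt α))

/-- The pair `(p, p')` is a relevant pair. -/
def relPair [LT B] (R : Rep K V0 A B) (S0 : Set V0) (Fv : V0 → QV) (p p' : V0) : Prop :=
  Fv p = Fv p' ∧ R.vle p p' ∧ p' ∉ S0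

/-- Condition of Hypothesis (H) on outgoing arrows at the relevant pair `(p, p')`. -/
def outOK [LT B] (R : Rep K V0 A B) (S0 : Set V0) (Fv : V0 → QV) (Fa : A → QA)
    (qsrc qtgt : QA → QV) (p p' : V0) (aq : QA) : Prop :=
  qsrc aq = Fv p →
    ((¬ ∃ α : A, Fa α = aq ∧ R.src α = p') →
      ∀ q : V0, Fv q = qtgt aq → R.type0 Fa aq q p') ∧
    ((∃ α : A, Fa α = aq ∧ R.src α = p') →
      ∃ α : A, Fa α = aq ∧ R.src α = p ∧
        (R.type1 Fa aq (R.tgt α) p' ∨ R.type2b S0 Fv Fa aq (R.tgt α) p'))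

/-- Condition of Hypothesis (H) on incoming arrows at the relevant pair `(p, p')`. -/
def inOK [LT B] (R : Rep K V0 A B) (S0 : Set V0) (Fv : V0 → QV) (Fa : A → QA)
    (qsrc qtgt : QA → QV) (p p' : V0) (aq : QA) : Prop :=
  qtgt aq = Fv p →
    ((¬ ∃ α : A, Fa α = aq ∧ R.tgt α = p) →
      ∀ q' : V0, Fv q' = qsrc aq → R.type0 Fa aq p q') ∧
    ((∃ α : A, Fa α = aq ∧ R.tgt α = p) →
      ∃ α : A, Fa α = aq ∧ R.tgt α = p' ∧
        (R.type1 Fa aq p (R.src α) ∨ R.type2a S0 Fv Fa aq p (R.src α)))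

/-- Exceptional situation (1) of Hypothesis (H). -/
def exc1 [LinearOrder B] (R : Rep K V0 A B) (S0 : Set V0) (S1 : Set A) (Fv : V0 → QV)
    (Fa : A → QA) (qsrc : QA → QV) (p p' : V0) (aq : QA) : Prop :=
  qsrc aq = Fv p ∧ ∃ α : A, Fa α = aq ∧ R.src α = p ∧
    (R.type2a S0 Fv Fa aq (R.tgt α) p' ∨ R.type4a S0 Fv Fa aq (R.tgt α) p') ∧
    (α ∈ S1 → R.IsIdMat α)

/-- Exceptional situation (2) of Hypothesis (H). -/
def exc2 [LT B] (R : Rep K V0 A B) (S0 : Set V0) (Fv : V0 → QV) (Fa : A → QA)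
    (qtgt : QA → QV) (p p' : V0) (aq : QA) : Prop :=
  qtgt aq = Fv p ∧ ∃ α : A, Fa α = aq ∧ R.tgt α = p' ∧
    (R.type2b S0 Fv Fa aq p (R.src α) ∨ R.type3a S0 Fv Fa aq p (R.src α))

/-- Hypothesis (H). -/
def HypH [LinearOrder B] (R : Rep K V0 A B) (S0 : Set V0) (S1 : Set A)
    (qsrc qtgt : QA → QV) (Fv : V0 → QV) (Fa : A → QA) : Prop :=
  R.StrictlyOrdered Fa ∧
  ∀ p p' : V0, R.relPair S0 Fv p p' →
    ((∀ aq : QA, R.outOK S0 Fv Fa qsrc qtgt p p' aq ∧ R.inOK S0 Fv Fa qsrc qtgt p p' aq) ∨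
     (∃ aq0 : QA,
        (R.exc1 S0 S1 Fv Fa qsrc p p' aq0 ∨ R.exc2 S0 Fv Fa qtgt p p' aq0) ∧
        ∀ aq : QA, aq ≠ aq0 →
          R.outOK S0 Fv Fa qsrc qtgt p p' aq ∧ R.inOK S0 Fv Fa qsrc qtgt p p' aq))


end Rep

end QGr

namespace QGr

section EchelonCells

variable {K I J : Type} [Field K] [LinearOrder I] [LinearOrder J]

/-- The rows of `v` indexed by `γ` are in reduced echelon form with pivots `γ`; the other rows
vanish. -/
structure Reduced (γ : Set I) (v : I → I → K) : Prop where
  zero : ∀ c, c ∉ γ → v c = 0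
  one : ∀ c, c ∈ γ → v c c = 1
  off : ∀ c b, b ≠ c → ¬(b < c ∧ b ∉ γ) → v c b = 0

/-- `W` belongs to the Schubert cell of the Grassmannian of `I → K` with pivots `γ`. -/
def IsCell (γ : Set I) (W : Submodule K (I → K)) : Prop :=
  ∃ v : I → I → K, Reduced γ v ∧ W = Submodule.span K (Set.range v)

theorem Reduced.expand [Fintype I] {γ : Set I} {v : I → I → K} (hv : Reduced γ v) {x : I → K}
    (hx : x ∈ Submodule.span K (Set.range v)) : x = ∑ c, x c • v c := by
  induction hx using Submodule.span_induction with
  | mem x h =>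
    obtain ⟨c, rfl⟩ := h
    rw [Finset.sum_eq_single c]
    · by_cases hc : c ∈ γ
      · rw [hv.one c hc, one_smul]
      · simp [hv.zero c hc]
    · intro b _ hb
      by_cases hbγ : b ∈ γ
      · rw [hv.off c b hb (fun h => h.2 hbγ), zero_smul]
      · rw [hv.zero b hbγ, smul_zero]
    · simp
  | zero => simp
  | add x y _ _ hx hy =>
    conv_lhs => rw [hx, hy]
    simp [add_smul, Finset.sum_add_distrib]
  | smul a x _ hx =>
    conv_lhs => rw [hx]
    simp [Finset.smul_sum, mul_smul]

theorem Reduced.ext_mem [Fintype I] {γ : Set I} {v : I → I → K} (hv : Reduced γ v) {x y : I → K}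
    (hx : x ∈ Submodule.span K (Set.range v)) (hy : y ∈ Submodule.span K (Set.range v))
    (h : ∀ c ∈ γ, x c = y c) : x = y := by
  rw [hv.expand hx, hv.expand hy]
  refine Finset.sum_congr rfl fun c _ => ?_
  by_cases hc : c ∈ γ
  · rw [h c hc]
  · rw [hv.zero c hc, smul_zero, smul_zero]

theorem Reduced.apply_mem {γ : Set I} {v : I → I → K} (hv : Reduced γ v) {c b : I}
    (hc : c ∈ γ) (hb : b ∈ γ) : v c b = if b = c then 1 else 0 := by
  split_ifs with h
  · rw [h, hv.one c hc]
  · exact hv.off c b h fun h => h.2 hb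

theorem Reduced.unique [Fintype I] {γ : Set I} {v w : I → I → K} (hv : Reduced γ v) (hw : Reduced γ w)
    (h : Submodule.span K (Set.range v) = Submodule.span K (Set.range w)) : v = w := by
  funext c
  by_cases hc : c ∈ γ
  · refine hv.ext_mem (Submodule.subset_span ⟨c, rfl⟩) (h ▸ Submodule.subset_span ⟨c, rfl⟩) ?_
    intro b hb
    rw [hv.apply_mem hc hb, hw.apply_mem hc hb]
  · rw [hv.zero c hc, hw.zero c hc]

theorem Reduced.finrank_span [Fintype I] {γ : Set I} {v : I → I → K} (hv : Reduced γ v) :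
    Module.finrank K (Submodule.span K (Set.range v)) = γ.ncard := by
  have hli : LinearIndependent K (fun c : γ => v c) := by
    rw [Fintype.linearIndependent_iff]
    intro g hg c
    have := congrFun hg c
    simp only [Finset.sum_apply, Pi.smul_apply, smul_eq_mul, Pi.zero_apply] at this
    rw [Finset.sum_eq_single c] at this
    · simpa [hv.one c c.2] using this
    · intro b _ hb
      rw [hv.apply_mem b.2 c.2, if_neg (fun h => hb (Subtype.ext h.symm)), mul_zero]
    · simp
  have hspan : Submodule.span K (Set.range v) =
      Submodule.span K (Set.range fun c : γ => v c) := by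
    refine le_antisymm (Submodule.span_le.2 ?_)
      (Submodule.span_mono (Set.range_subset_iff.2 fun c => ⟨c, rfl⟩))
    rintro _ ⟨c, rfl⟩
    by_cases hc : c ∈ γ
    · exact Submodule.subset_span ⟨⟨c, hc⟩, rfl⟩
    · rw [hv.zero c hc]
      exact Submodule.zero_mem _
  rw [hspan, finrank_span_eq_card hli, ← Nat.card_eq_fintype_card, Nat.card_coe_set_eq]

/-- The reduced echelon matrix of a subspace in the cell with pivots `γ`. -/
def row (γ : Set I) (W : Submodule K (I → K)) : I → I → K :=
  if h : IsCell γ W then h.choose else 0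

theorem IsCell.reduced_row {γ : Set I} {W : Submodule K (I → K)} (h : IsCell γ W) :
    Reduced γ (row γ W) := by
  rw [row, dif_pos h]
  exact h.choose_spec.1

theorem IsCell.span_row {γ : Set I} {W : Submodule K (I → K)} (h : IsCell γ W) :
    Submodule.span K (Set.range (row γ W)) = W := by
  rw [row, dif_pos h]
  exact h.choose_spec.2.symm

theorem Reduced.row_span [Fintype I] {γ : Set I} {v : I → I → K} (hv : Reduced γ v) :
    row γ (Submodule.span K (Set.range v)) = v :=
  have h : IsCell γ (Submodule.span K (Set.range v)) := ⟨v, hv, rfl⟩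
  h.reduced_row.unique hv h.span_row

theorem IsCell.eq_of_row_eq {γ : Set I} {W W' : Submodule K (I → K)} (h : IsCell γ W)
    (h' : IsCell γ W') (hr : row γ W = row γ W') : W = W' := by
  rw [← h.span_row, hr, h'.span_row]

theorem IsCell.row_mem {γ : Set I} {W : Submodule K (I → K)} (h : IsCell γ W) (c : I) :
    row γ W c ∈ W :=
  h.span_row.le (Submodule.subset_span ⟨c, rfl⟩)

theorem IsCell.expand [Fintype I] {γ : Set I} {W : Submodule K (I → K)} (h : IsCell γ W) {x : I → K}
    (hx : x ∈ W) : x = ∑ c, x c • row γ W c :=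
  h.reduced_row.expand (by rwa [h.span_row])

theorem isCell_bot : IsCell (∅ : Set I) (⊥ : Submodule K (I → K)) := by
  refine ⟨0, ⟨fun _ _ => rfl, fun _ h => h.elim, fun _ _ _ _ => rfl⟩, ?_⟩
  rw [eq_comm, Submodule.span_eq_bot]
  rintro _ ⟨c, rfl⟩
  rfl

theorem IsCell.subset_of_le [Fintype I] {γ δ : Set I} {U W : Submodule K (I → K)} (hU : IsCell γ U)
    (hW : IsCell δ W) (hle : U ≤ W) : γ ⊆ δ := by
  intro c hc
  by_contra hcδ
  have h := congrFun (hW.expand (hle (hU.row_mem c))) c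
  rw [hU.reduced_row.one c hc, Finset.sum_apply, Finset.sum_eq_zero] at h
  · exact one_ne_zero h
  intro d _
  rw [Pi.smul_apply, smul_eq_mul]
  rcases lt_trichotomy d c with hd | rfl | hd
  · rw [hW.reduced_row.off d c hd.ne' (fun h => hd.not_gt h.1), mul_zero]
  · rw [hW.reduced_row.zero d hcδ, Pi.zero_apply, mul_zero]
  · rw [hU.reduced_row.off c d hd.ne' (fun h => hd.not_gt h.1), zero_mul]

/-- The subspaces in the cell `γ` lying in a fixed member of the cell `δ` form an affine space,
with coordinates not depending on the member. -/
theorem bijOn_row_below [Fintype I] {γ δ : Set I} (hγδ : γ ⊆ δ) {U : Submodule K (I → K)}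
    (hU : IsCell δ U) :
    Set.BijOn (fun W (q : {q : I × I // q.1 ∈ γ ∧ q.2 ∈ δ ∧ q.2 ∉ γ ∧ q.2 < q.1}) =>
      row γ W q.1.1 q.1.2) {W : Submodule K (I → K) | IsCell γ W ∧ W ≤ U} Set.univ := by
  have hu := hU.reduced_row
  refine ⟨fun _ _ => Set.mem_univ _, ?_, ?_⟩
  · rintro W ⟨hW, hWU⟩ W' ⟨hW', hWU'⟩ hq
    refine hW.eq_of_row_eq hW' (funext fun c => ?_)
    by_cases hc : c ∈ γ
    · refine hu.ext_mem (by rw [hU.span_row]; exact hWU (hW.row_mem c))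
        (by rw [hU.span_row]; exact hWU' (hW'.row_mem c)) fun d hd => ?_
      by_cases hdγ : d ∈ γ
      · rw [hW.reduced_row.apply_mem hc hdγ, hW'.reduced_row.apply_mem hc hdγ]
      · by_cases hdc : d < c
        · exact congrFun hq ⟨(c, d), hc, hd, hdγ, hdc⟩
        · have hne : d ≠ c := fun h => hdγ (h ▸ hc)
          rw [hW.reduced_row.off c d hne (fun h => hdc h.1),
            hW'.reduced_row.off c d hne (fun h => hdc h.1)]
    · rw [hW.reduced_row.zero c hc, hW'.reduced_row.zero c hc]
  · intro l _
    set u := row δ U with hu_def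
    let L : I → I → K := fun c d =>
      if h : c ∈ γ ∧ d ∈ δ ∧ d ∉ γ ∧ d < c then l ⟨(c, d), h⟩ else 0
    let w : I → I → K := fun c => if c ∈ γ then u c + ∑ d, L c d • u d else 0
    have hLmem : ∀ c d b, L c d * u d b ≠ 0 → d ∈ δ ∧ d ∉ γ ∧ d < c ∧
        (b = d ∨ b < d ∧ b ∉ δ) := by
      intro c d b h
      by_cases hcd : c ∈ γ ∧ d ∈ δ ∧ d ∉ γ ∧ d < c
      · refine ⟨hcd.2.1, hcd.2.2.1, hcd.2.2.2, ?_⟩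
        by_contra! hb
        refine h ?_
        rw [hu.off d b hb.1 (fun h => h.2 (hb.2 h.1)), mul_zero]
      · exact absurd (by simp only [L]; rw [dif_neg hcd, zero_mul]) h
    have hw : Reduced γ w := by
      refine ⟨fun c hc => if_neg hc, fun c hc => ?_, fun c b hbc hb => ?_⟩
      · simp only [w, if_pos hc, Pi.add_apply, Finset.sum_apply, Pi.smul_apply, smul_eq_mul]
        rw [hu.one c (hγδ hc), Finset.sum_eq_zero, add_zero]
        intro d _
        by_contra h
        obtain ⟨-, h2, -, h4⟩ := hLmem c d c h
        rcases h4 with rfl | h4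
        · exact h2 hc
        · exact h4.2 (hγδ hc)
      · by_cases hc : c ∈ γ
        · simp only [w, if_pos hc, Pi.add_apply, Finset.sum_apply, Pi.smul_apply, smul_eq_mul]
          rw [hu.off c b hbc (fun h => hb ⟨h.1, fun h' => h.2 (hγδ h')⟩), Finset.sum_eq_zero,
            add_zero]
          intro d _
          by_contra h
          obtain ⟨-, h2, h3, h4⟩ := hLmem c d b h
          rcases h4 with rfl | h4
          · exact hb ⟨h3, h2⟩
          · exact hb ⟨h4.1.trans h3, fun h' => h4.2 (hγδ h')⟩
        · simp [w, if_neg hc]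
    refine ⟨Submodule.span K (Set.range w), ⟨⟨w, hw, rfl⟩, Submodule.span_le.2 ?_⟩, ?_⟩
    · rintro _ ⟨c, rfl⟩
      simp only [w]
      split_ifs
      · exact U.add_mem (hU.row_mem c)
          (U.sum_mem fun d _ => U.smul_mem _ (hU.row_mem d))
      · exact U.zero_mem
    · funext ⟨⟨c, d⟩, h⟩
      dsimp only at h ⊢
      rw [hw.row_span]
      simp only [w, if_pos h.1, Pi.add_apply, Finset.sum_apply, Pi.smul_apply, smul_eq_mul]
      rw [hu.off c d h.2.2.2.ne (fun h' => h'.2 h.2.1), zero_add, Finset.sum_eq_single d]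
      · simp only [L]
        rw [dif_pos h, hu.one d h.2.1, mul_one]
      · intro b _ hb
        by_contra h'
        rcases (hLmem c b d h').2.2.2 with h4 | h4
        · exact hb h4.symm
        · exact h4.2 h.2.1
      · simp

/-- The subspaces in the cell `δ` containing a fixed member of the cell `γ` form an affine space,
with coordinates not depending on the member. -/
theorem bijOn_row_above [Fintype I] {γ δ : Set I} (hγδ : γ ⊆ δ) {U : Submodule K (I → K)}
    (hU : IsCell γ U) :
    Set.BijOn (fun W (q : {q : I × I // q.1 ∈ δ ∧ q.1 ∉ γ ∧ q.2 ∉ δ ∧ q.2 < q.1}) =>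
      row δ W q.1.1 q.1.2) {W : Submodule K (I → K) | IsCell δ W ∧ U ≤ W} Set.univ := by
  have hu := hU.reduced_row
  refine ⟨fun _ _ => Set.mem_univ _, ?_, ?_⟩
  · rintro W ⟨hW, hWU⟩ W' ⟨hW', hWU'⟩ hq
    have hfree : ∀ d, d ∉ γ → row δ W d = row δ W' d := by
      intro d hdγ
      by_cases hd : d ∈ δ
      · funext b
        by_cases hb : b ∈ δ
        · rw [hW.reduced_row.apply_mem hd hb, hW'.reduced_row.apply_mem hd hb]
        · by_cases hbd : b < d
          · exact congrFun hq ⟨(d, b), hd, hdγ, hb, hbd⟩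
          · have hne : b ≠ d := fun h => hb (h ▸ hd)
            rw [hW.reduced_row.off d b hne (fun h => hbd h.1),
              hW'.reduced_row.off d b hne (fun h => hbd h.1)]
      · rw [hW.reduced_row.zero d hd, hW'.reduced_row.zero d hd]
    refine hW.eq_of_row_eq hW' (funext fun c => ?_)
    by_cases hc : c ∈ γ
    · have h1 := hW.expand (hWU (hU.row_mem c))
      have h2 := hW'.expand (hWU' (hU.row_mem c))
      rw [← Finset.add_sum_erase _ _ (Finset.mem_univ c), hu.one c hc, one_smul] at h1 h2
      have h3 : ∀ d ∈ Finset.univ.erase c, row γ U c d • row δ W d = row γ U c d • row δ W' d := by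
        intro d hd
        by_cases hdγ : d ∈ γ
        · rw [hu.off c d (Finset.ne_of_mem_erase hd) (fun h => h.2 hdγ), zero_smul, zero_smul]
        · rw [hfree d hdγ]
      rw [Finset.sum_congr rfl h3] at h1
      exact add_right_cancel (h1.symm.trans h2)
    · exact hfree c hc
  · intro l _
    set u := row γ U with hu_def
    let f : I → I → K := fun d b => if d ∈ δ ∧ d ∉ γ then
      (if b = d then 1 else if h : d ∈ δ ∧ d ∉ γ ∧ b ∉ δ ∧ b < d then l ⟨(d, b), h⟩ else 0) else 0
    have hf0 : ∀ d, ¬(d ∈ δ ∧ d ∉ γ) → f d = 0 := fun d hd => funext fun b => if_neg hd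
    have hf1 : ∀ d, d ∈ δ ∧ d ∉ γ → f d d = 1 := fun d hd => by
      simp only [f]
      rw [if_pos hd, if_pos trivial]
    have hfoff : ∀ d b, b ≠ d → ¬(b < d ∧ b ∉ δ) → f d b = 0 := fun d b hbd hb => by
      simp only [f]
      rw [if_neg hbd, dif_neg (fun h => hb ⟨h.2.2.2, h.2.2.1⟩), ite_self]
    let w : I → I → K := fun c => if c ∈ γ then u c - ∑ d, u c d • f d else f c
    have hw : Reduced δ w := by
      refine ⟨fun c hc => ?_, fun c hc => ?_, fun c b hbc hb => ?_⟩
      · simp only [w]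
        rw [if_neg (fun h => hc (hγδ h)), hf0 c (fun h => hc h.1)]
      · by_cases hcγ : c ∈ γ
        · simp only [w, if_pos hcγ, Pi.sub_apply, Finset.sum_apply, Pi.smul_apply, smul_eq_mul]
          rw [hu.one c hcγ, Finset.sum_eq_zero, sub_zero]
          intro d _
          by_cases hdc : c = d
          · rw [← hdc, hf0 c (fun h => h.2 hcγ), Pi.zero_apply, mul_zero]
          · rw [hfoff d c hdc (fun h => h.2 hc), mul_zero]
        · simp only [w]
          rw [if_neg hcγ, hf1 c ⟨hc, hcγ⟩]
      · by_cases hcγ : c ∈ γ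
        · simp only [w, if_pos hcγ, Pi.sub_apply, Finset.sum_apply, Pi.smul_apply, smul_eq_mul]
          by_cases hbδ : b ∈ δ ∧ b ∉ γ
          · rw [Finset.sum_eq_single b, hf1 b hbδ, mul_one, sub_self]
            · intro d _ hdb
              rw [hfoff d b hdb.symm (fun h => h.2 hbδ.1), mul_zero]
            · simp
          · have hbγ : ¬(b < c ∧ b ∉ γ) := fun h =>
              hb ⟨h.1, fun h' => hbδ ⟨h', h.2⟩⟩
            rw [hu.off c b hbc hbγ, Finset.sum_eq_zero, sub_zero]
            intro d _
            by_cases hd : d ∈ δ ∧ d ∉ γ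
            · by_cases hdc : d < c
              · rw [hfoff d b (fun h => hbδ (h ▸ hd)) (fun h => hb ⟨h.1.trans hdc, h.2⟩),
                  mul_zero]
              · rw [hu.off c d (fun h => hd.2 (h ▸ hcγ)) (fun h => hdc h.1), zero_mul]
            · rw [hf0 d hd, Pi.zero_apply, mul_zero]
        · simp only [w]
          rw [if_neg hcγ, hfoff c b hbc hb]
    have hfmem : ∀ d, f d ∈ Submodule.span K (Set.range w) := by
      intro d
      by_cases hd : d ∈ δ ∧ d ∉ γ
      · refine Submodule.subset_span ⟨d, ?_⟩
        simp only [w]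
        rw [if_neg hd.2]
      · rw [hf0 d hd]
        exact Submodule.zero_mem _
    refine ⟨Submodule.span K (Set.range w), ⟨⟨w, hw, rfl⟩, ?_⟩, ?_⟩
    · rw [← hU.span_row, Submodule.span_le]
      rintro _ ⟨c, rfl⟩
      by_cases hc : c ∈ γ
      · have : u c = w c + ∑ d, u c d • f d := by
          simp only [w]
          rw [if_pos hc, sub_add_cancel]
        change u c ∈ _
        rw [this]
        exact Submodule.add_mem _ (Submodule.subset_span ⟨c, rfl⟩)
          (Submodule.sum_mem _ fun d _ => Submodule.smul_mem _ _ (hfmem d))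
      · change u c ∈ _
        rw [hu.zero c hc]
        exact Submodule.zero_mem _
    · funext ⟨⟨d, b⟩, h⟩
      dsimp only at h ⊢
      rw [hw.row_span]
      simp only [w, f]
      rw [if_neg h.2.1, if_pos ⟨h.1, h.2.1⟩, if_neg h.2.2.2.ne, dif_pos h]

/-- Transport of subspaces along a bijection of the coordinates. -/
def reindex (e : I ≃o J) (W : Submodule K (J → K)) : Submodule K (I → K) :=
  W.comap (LinearMap.funLeft K K e.symm)

theorem reindex_reindex_symm (e : I ≃o J) (W : Submodule K (I → K)) :
    reindex e (reindex e.symm W) = W := by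
  ext x
  simp only [reindex, Submodule.mem_comap]
  convert Iff.rfl using 2
  funext i
  simp [LinearMap.funLeft_apply]

theorem IsCell.reindex {δ : Set J} {W : Submodule K (J → K)} (hW : IsCell δ W) (e : I ≃o J) :
    IsCell (e ⁻¹' δ) (reindex e W) := by
  obtain ⟨v, hv, rfl⟩ := hW
  refine ⟨fun c b => v (e c) (e b), ⟨fun c hc => ?_, fun c hc => hv.one _ hc, fun c b hbc hb => ?_⟩,
    ?_⟩
  · funext b
    rw [hv.zero (e c) hc]
    rfl
  · refine hv.off _ _ (fun h => hbc (e.injective h)) fun h => hb ⟨?_, h.2⟩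
    exact e.lt_iff_lt.1 h.1
  · have hcomap : QGr.reindex e (Submodule.span K (Set.range v)) =
        (Submodule.span K (Set.range v)).map (LinearMap.funLeft K K e) := by
      ext x
      simp only [QGr.reindex, Submodule.mem_comap, Submodule.mem_map]
      constructor
      · intro h
        refine ⟨_, h, ?_⟩
        funext i
        simp [LinearMap.funLeft_apply]
      · rintro ⟨y, hy, rfl⟩
        convert hy
        funext i
        simp [LinearMap.funLeft_apply]
    rw [hcomap, Submodule.map_span]
    congr 1
    ext x
    simp only [Set.mem_image, Set.mem_range, exists_exists_eq_and]
    constructor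
    · rintro ⟨c, rfl⟩
      refine ⟨e.symm c, ?_⟩
      funext b
      simp [LinearMap.funLeft_apply]
    · rintro ⟨c, rfl⟩
      exact ⟨e c, rfl⟩

theorem bijOn_row_reindex_above [Fintype I] {γ : Set I} {δ : Set J} (e : I ≃o J) (hγδ : γ ⊆ e ⁻¹' δ)
    {U : Submodule K (I → K)} (hU : IsCell γ U) :
    Set.BijOn (fun W (q : {q : I × I // q.1 ∈ e ⁻¹' δ ∧ q.1 ∉ γ ∧ q.2 ∉ e ⁻¹' δ ∧ q.2 < q.1}) =>
      row (e ⁻¹' δ) (reindex e W) q.1.1 q.1.2)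
      {W : Submodule K (J → K) | IsCell δ W ∧ U ≤ reindex e W} Set.univ := by
  refine (bijOn_row_above hγδ hU).comp (g := _) (f := reindex e) ⟨?_, ?_, ?_⟩
  · exact fun W hW => ⟨hW.1.reindex e, hW.2⟩
  · intro W _ W' _ h
    exact (reindex_reindex_symm e.symm W).symm.trans
      ((congrArg (reindex e.symm) h).trans (reindex_reindex_symm e.symm W'))
  · intro W hW
    refine ⟨reindex e.symm W, ⟨?_, ?_⟩, reindex_reindex_symm e W⟩
    · convert hW.1.reindex e.symm
      ext j
      simp
    · rw [reindex_reindex_symm]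
      exact hW.2

end EchelonCells

section Extension

/-- Extending a product parametrization of a set of dependent functions by one coordinate. -/
theorem bijOn_extend {V K Y ι κ : Type} {X : V → Type} (x₀ : ∀ p, X p) (v : V)
    {A A' : Set (∀ p, X p)} (hA : ∀ y ∈ A, y v = x₀ v)
    (hA' : ∀ z ∈ A', Function.update z v (x₀ v) ∈ A)
    {ρ : (∀ p, X p) → Y} (hρ : ∀ z w, ρ (Function.update z v w) = ρ z) {Z : Set Y}
    {f : (∀ p, X p) → ι → K} (hf : Set.BijOn (fun x => (ρ x, f x)) A (Z ×ˢ Set.univ))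
    {code : X v → κ → K}
    (hcode : ∀ y ∈ A, Set.BijOn code {w | Function.update y v w ∈ A'} Set.univ) :
    Set.BijOn (fun x => (ρ x, Sum.elim (f (Function.update x v (x₀ v))) (code (x v))))
      A' (Z ×ˢ Set.univ) := by
  refine ⟨?_, ?_, ?_⟩
  · intro z hz
    have := (hf.mapsTo (hA' z hz)).1
    simp only [hρ] at this
    exact ⟨this, Set.mem_univ _⟩
  · intro z hz z' hz' h
    simp only [Prod.mk.injEq] at h
    obtain ⟨h1, h2⟩ := h
    have hl := congrArg (fun g => g ∘ Sum.inl) h2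
    have hr := congrArg (fun g => g ∘ Sum.inr) h2
    simp only [Sum.elim_comp_inl, Sum.elim_comp_inr] at hl hr
    have hy : Function.update z v (x₀ v) = Function.update z' v (x₀ v) :=
      hf.injOn (hA' z hz) (hA' z' hz') (by simp only [hρ, h1, hl])
    have hv : z v = z' v := by
      refine (hcode _ (hA' z hz)).injOn ?_ ?_ hr
      · simpa using hz
      · simp only [Set.mem_ofPred_eq]
        rw [hy]
        simpa using hz'
    have := congrArg (fun g => Function.update g v (z v)) hy
    simp only [Function.update_idem, Function.update_eq_self] at this
    rw [this, hv, Function.update_eq_self]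
  · rintro ⟨y, g⟩ ⟨hy, -⟩
    obtain ⟨x, hx, hxy⟩ := hf.surjOn (show (y, g ∘ Sum.inl) ∈ Z ×ˢ Set.univ from ⟨hy, trivial⟩)
    obtain ⟨w, hw, hwg⟩ := (hcode x hx).surjOn (Set.mem_univ (g ∘ Sum.inr))
    refine ⟨_, hw, ?_⟩
    simp only [Prod.mk.injEq] at hxy
    have hxv : Function.update x v (x₀ v) = x := by
      rw [← hA x hx, Function.update_eq_self]
    simp only [hρ, Function.update_self, Function.update_idem, hxv, hxy.1, hxy.2, hwg,
      Sum.elim_comp_inl_inr]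

end Extension

namespace Rep

variable {K V0 A B : Type} [Field K]

/-- The elements of `β` sitting at the vertex `p`. -/
def pivots (R : Rep K V0 A B) (β : Finset B) (p : V0) : Set {b : B // R.vtx b = p} :=
  {i | i.val ∈ β}

theorem pivots_filter (R : Rep K V0 A B) (S0 : Set V0) (β : Finset B) {p : V0} (hp : p ∈ S0) :
    R.pivots (β.filter fun b => R.vtx b ∈ S0) p = R.pivots β p := by
  ext i
  simp [pivots, i.prop, hp]

variable [LinearOrder B]

theorem exists_span_iff_isCell (R : Rep K V0 A B) (β : Finset B) (p : V0)
    (W : Submodule K ({b : B // R.vtx b = p} → K)) :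
    (∃ v : {b : B // b ∈ β ∧ R.vtx b = p} → ({b : B // R.vtx b = p} → K),
      (∀ b0, v b0 ⟨b0.val, b0.prop.2⟩ = 1) ∧
      (∀ b0 b1, b1.val ≠ b0.val → ¬(b1.val < b0.val ∧ b1.val ∉ β) → v b0 b1 = 0) ∧
      W = Submodule.span K (Set.range v)) ↔ IsCell (R.pivots β p) W := by
  constructor
  · rintro ⟨v, h1, h2, rfl⟩
    refine ⟨fun c => if h : c.val ∈ β then v ⟨c.val, h, c.prop⟩ else 0, ⟨?_, ?_, ?_⟩, ?_⟩
    · exact fun c hc => dif_neg hc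
    · intro c hc
      rw [dif_pos (show c.val ∈ β from hc)]
      exact h1 ⟨c.val, hc, c.prop⟩
    · intro c b hbc hb
      split_ifs with hc
      · exact h2 _ _ (fun h => hbc (Subtype.ext h)) hb
      · rfl
    · refine le_antisymm (Submodule.span_mono ?_) (Submodule.span_le.2 ?_)
      · rintro _ ⟨c, rfl⟩
        exact ⟨⟨c.val, c.prop.2⟩, dif_pos c.prop.1⟩
      · rintro _ ⟨c, rfl⟩
        dsimp only
        split_ifs with hc
        · exact Submodule.subset_span ⟨_, rfl⟩
        · exact Submodule.zero_mem _
  · rintro ⟨v, hv, rfl⟩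
    refine ⟨fun c => v ⟨c.val, c.prop.2⟩, fun c => hv.one _ c.prop.1, fun c b hbc hb => ?_, ?_⟩
    · exact hv.off _ _ (fun h => hbc (congrArg Subtype.val h)) hb
    · refine le_antisymm (Submodule.span_le.2 ?_) (Submodule.span_mono ?_)
      · rintro _ ⟨c, rfl⟩
        by_cases hc : c.val ∈ β
        · exact Submodule.subset_span ⟨⟨c.val, hc, c.prop⟩, rfl⟩
        · rw [hv.zero c hc]
          exact Submodule.zero_mem _
      · rintro _ ⟨c, rfl⟩
        exact ⟨_, rfl⟩

variable [Fintype B]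

theorem finrank_of_isCell (R : Rep K V0 A B) (β : Finset B) (p : V0)
    {W : Submodule K ({b : B // R.vtx b = p} → K)} (hW : IsCell (R.pivots β p) W) :
    Module.finrank K W = (β.filter fun b => R.vtx b = p).card := by
  obtain ⟨v, hv, rfl⟩ := hW
  rw [hv.finrank_span, ← Set.ncard_image_of_injective _ Subtype.val_injective,
    ← Set.ncard_coe_finset]
  congr 1
  ext b
  simp [pivots, and_comm]

theorem mem_cell_iff (R : Rep K V0 A B) (β : Finset B) (W : R.SubRep) :
    W ∈ R.Cell β ↔ R.IsSubrep W ∧ ∀ p, IsCell (R.pivots β p) (W p) := by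
  refine and_congr_right fun _ => ⟨fun h p => ?_, fun h => ⟨fun p => ?_, fun p => ?_⟩⟩
  · exact (R.exists_span_iff_isCell β p _).1 (h.2 p)
  · exact R.finrank_of_isCell β p (h p)
  · exact (R.exists_span_iff_isCell β p _).2 (h p)

theorem mem_cellOn_iff (R : Rep K V0 A B) (S0 : Set V0) (S1 : Set A) (β : Finset B)
    (W : R.SubRepOn S0) :
    W ∈ R.CellOn S0 S1 β ↔
      R.IsSubrepOn S0 S1 W ∧ ∀ p : {p : V0 // p ∈ S0}, IsCell (R.pivots β p) (W p) := by
  refine and_congr_right fun _ => ⟨fun h p => ?_, fun h => ⟨fun p => ?_, fun p => ?_⟩⟩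
  · exact (R.exists_span_iff_isCell β p _).1 (h.2 p)
  · exact R.finrank_of_isCell β p (h p)
  · exact (R.exists_span_iff_isCell β p _).2 (h p)

theorem IsIdMat.exists_le_reindex_iff {R : Rep K V0 A B} (hlin : R.Linear) {a : A}
    (ha : R.IsIdMat a) :
    ∃ e : {b : B // R.vtx b = R.src a} ≃o {b : B // R.vtx b = R.tgt a},
      ∀ (U : Submodule K ({b : B // R.vtx b = R.src a} → K))
        (W : Submodule K ({b : B // R.vtx b = R.tgt a} → K)),
        (∀ x ∈ U, R.mmap a x ∈ W) ↔ U ≤ reindex e W := by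
  obtain ⟨e, he⟩ := ha
  have hL : (hlin a).mk' = LinearMap.funLeft K K e.symm := by
    refine (Pi.basisFun K _).ext fun i => ?_
    rw [Pi.basisFun_apply, IsLinearMap.mk'_apply]
    refine Eq.trans ?_ ((he i).trans ?_)
    · congr!
    · funext j
      simp only [LinearMap.funLeft_apply, Pi.single_apply, OrderIso.symm_apply_eq]
  refine ⟨e, fun U W => forall₂_congr fun x _ => ?_⟩
  rw [← IsLinearMap.mk'_apply (hlin a), hL]
  rfl

/-- Families of subspaces in the cells of `β` that agree with `W₀` outside `T`, are stable under
the arrows in `E`, and restrict to a subrepresentation on `(S0, S1)`. -/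
def admissible (R : Rep K V0 A B) (S0 : Set V0) (S1 : Set A) (β : Finset B) (W₀ : R.SubRep)
    (T : Set V0) (E : Set A) : Set (∀ p : V0, Submodule K ({b : B // R.vtx b = p} → K)) :=
  {W | (∀ p, p ∉ T → W p = W₀ p) ∧ (∀ p, IsCell (R.pivots β p) (W p)) ∧
    R.IsSubrepOn S0 S1 (R.resOn S0 W) ∧
    ∀ a ∈ E, ∀ x ∈ W (R.src a), R.mmap a x ∈ W (R.tgt a)}

/-- The admissible families are parametrized by the cell over `(S0, S1)` times an affine space. -/
def Parametrized (R : Rep K V0 A B) (S0 : Set V0) (S1 : Set A) (β : Finset B) (W₀ : R.SubRep)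
    (T : Set V0) (E : Set A) : Prop :=
  ∃ (ι : Type) (_ : Finite ι)
    (f : (∀ p : V0, Submodule K ({b : B // R.vtx b = p} → K)) → ι → K),
    Set.BijOn (fun W => (R.resOn S0 W, f W)) (R.admissible S0 S1 β W₀ T E)
      (R.CellOn S0 S1 (β.filter fun b => R.vtx b ∈ S0) ×ˢ Set.univ)

variable {R : Rep K V0 A B} {S0 : Set V0} {S1 : Set A} {β : Finset B} {W₀ : R.SubRep}
  {T : Set V0} {E : Set A}

theorem parametrized_base (hW₀ : W₀ ∈ R.Cell β) : R.Parametrized S0 S1 β W₀ S0 ∅ := by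
  rw [mem_cell_iff] at hW₀
  refine ⟨Empty, inferInstance, fun _ => Empty.elim, ?_, ?_, ?_⟩
  · rintro W ⟨-, h2, h3, -⟩
    refine ⟨(R.mem_cellOn_iff _ _ _ _).2 ⟨h3, fun p => ?_⟩, trivial⟩
    rw [R.pivots_filter S0 β p.prop]
    exact h2 p
  · intro W hW W' hW' h
    funext p
    by_cases hp : p ∈ S0
    · exact congrFun (congrArg Prod.fst h) ⟨p, hp⟩
    · rw [hW.1 p hp, hW'.1 p hp]
  · rintro ⟨Y, g⟩ ⟨hY, -⟩
    obtain ⟨hY1, hY2⟩ := (R.mem_cellOn_iff _ _ _ _).1 hY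
    let W : ∀ p : V0, Submodule K ({b : B // R.vtx b = p} → K) :=
      fun p => if h : p ∈ S0 then Y ⟨p, h⟩ else W₀ p
    have hres : R.resOn S0 W = Y := funext fun p => dif_pos p.prop
    refine ⟨W, ⟨fun p hp => dif_neg hp, fun p => ?_, ?_, fun a ha => ha.elim⟩, ?_⟩
    · by_cases hp : p ∈ S0
      · simp only [W]
        rw [dif_pos hp, ← R.pivots_filter S0 β hp]
        exact hY2 ⟨p, hp⟩
      · simp only [W]
        rw [dif_neg hp]
        exact hW₀.2 p
    · rw [hres]
      exact hY1
    · exact Prod.ext hres (Subsingleton.elim _ _)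

theorem Parametrized.extend (hP : R.Parametrized S0 S1 β W₀ T E) (hW₀ : W₀ ∈ R.Cell β)
    (hT : S0 ⊆ T) (hE : ∀ a ∈ E, R.src a ∈ T ∧ R.tgt a ∈ T) {v : V0} (hv : v ∉ T)
    {E' : Set A} (hEE' : E ⊆ E') {κ : Type} [Finite κ]
    {code : Submodule K ({b : B // R.vtx b = v} → K) → κ → K}
    {C : (∀ p : V0, Submodule K ({b : B // R.vtx b = p} → K)) →
      Set (Submodule K ({b : B // R.vtx b = v} → K))}
    (hcode : ∀ y ∈ R.admissible S0 S1 β W₀ T E, Set.BijOn code (C y) Set.univ)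
    (hC : ∀ y ∈ R.admissible S0 S1 β W₀ T E, ∀ w, w ∈ C y ↔
      IsCell (R.pivots β v) w ∧ ∀ a ∈ E', a ∉ E → ∀ x ∈ Function.update y v w (R.src a),
        R.mmap a x ∈ Function.update y v w (R.tgt a)) :
    R.Parametrized S0 S1 β W₀ (insert v T) E' := by
  rw [mem_cell_iff] at hW₀
  obtain ⟨ι, _, f, hf⟩ := hP
  have hne : ∀ p ∈ T, p ≠ v := fun p hp h => hv (h ▸ hp)
  have hρ : ∀ z w, R.resOn S0 (Function.update z v w) = R.resOn S0 z := fun z w =>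
    funext fun p => Function.update_of_ne (hne p (hT p.prop)) _ _
  refine ⟨ι ⊕ κ, inferInstance, _, bijOn_extend W₀ v (fun y hy => hy.1 v hv) ?_ hρ hf
    (code := code) fun y hy => ?_⟩
  · rintro z ⟨h1, h2, h3, h4⟩
    refine ⟨fun p hp => ?_, fun p => ?_, ?_, fun a ha => ?_⟩
    · rcases eq_or_ne p v with rfl | hpv
      · rw [Function.update_self]
      · rw [Function.update_of_ne hpv]
        exact h1 p fun h => hp (h.resolve_left hpv)
    · rcases eq_or_ne p v with rfl | hpv
      · rw [Function.update_self]
        exact hW₀.2 p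
      · rw [Function.update_of_ne hpv]
        exact h2 p
    · rw [hρ]
      exact h3
    · rw [Function.update_of_ne (hne _ (hE a ha).1), Function.update_of_ne (hne _ (hE a ha).2)]
      exact h4 a (hEE' ha)
  · convert hcode y hy using 1
    ext w
    rw [hC y hy]
    constructor
    · rintro ⟨-, h2, -, h4⟩
      refine ⟨?_, fun a ha _ => h4 a ha⟩
      simpa using h2 v
    · rintro ⟨hw, ha⟩
      refine ⟨fun p hp => ?_, fun p => ?_, ?_, fun a haE' => ?_⟩
      · rw [Set.mem_insert_iff, not_or] at hp
        rw [Function.update_of_ne hp.1]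
        exact hy.1 p hp.2
      · rcases eq_or_ne p v with rfl | hpv
        · rw [Function.update_self]
          exact hw
        · rw [Function.update_of_ne hpv]
          exact hy.2.1 p
      · rw [hρ]
        exact hy.2.2.1
      · by_cases haE : a ∈ E
        · rw [Function.update_of_ne (hne _ (hE a haE).1),
            Function.update_of_ne (hne _ (hE a haE).2)]
          exact hy.2.2.2 a haE
        · exact ha a haE' haE

theorem Parametrized.extend_vertex (hP : R.Parametrized S0 S1 β W₀ T E) (hW₀ : W₀ ∈ R.Cell β)
    (hT : S0 ⊆ T) (hE : ∀ a ∈ E, R.src a ∈ T ∧ R.tgt a ∈ T) {v : V0} (hv : v ∉ T) :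
    R.Parametrized S0 S1 β W₀ (insert v T) E := by
  have hbij := bijOn_row_above (K := K) (Set.empty_subset (R.pivots β v)) isCell_bot
  exact hP.extend hW₀ hT hE hv le_rfl (fun _ _ => hbij) fun y _ w =>
    and_congr_right fun _ => iff_of_true bot_le fun a h h' => absurd h h'

theorem Parametrized.extend_tgt (hP : R.Parametrized S0 S1 β W₀ T E) (hlin : R.Linear)
    (hW₀ : W₀ ∈ R.Cell β) (hT : S0 ⊆ T) (hE : ∀ a ∈ E, R.src a ∈ T ∧ R.tgt a ∈ T) {a : A}
    (ha : R.IsIdMat a) (hs : R.src a ∈ T) (ht : R.tgt a ∉ T) :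
    R.Parametrized S0 S1 β W₀ (insert (R.tgt a) T) (insert a E) := by
  have hW₀' := (R.mem_cell_iff _ _).1 hW₀
  obtain ⟨e, he⟩ := ha.exists_le_reindex_iff hlin
  have hsub : R.pivots β (R.src a) ⊆ e ⁻¹' R.pivots β (R.tgt a) :=
    (hW₀'.2 _).subset_of_le ((hW₀'.2 _).reindex e) ((he _ _).1 (hW₀'.1 a))
  have haE : a ∉ E := fun h => ht (hE a h).2
  have hne : R.src a ≠ R.tgt a := fun h => ht (h ▸ hs)
  have hbij := fun y (hy : y ∈ R.admissible S0 S1 β W₀ T E) =>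
    bijOn_row_reindex_above e hsub (hy.2.1 (R.src a))
  refine hP.extend hW₀ hT hE ht (Set.subset_insert a E) hbij fun y hy w => ?_
  refine and_congr_right fun _ => ?_
  rw [← he]
  constructor
  · rintro h a' (rfl | ha') ha'E
    · rwa [Function.update_self, Function.update_of_ne hne]
    · exact absurd ha' ha'E
  · intro h
    have := h a (Set.mem_insert a E) haE
    rwa [Function.update_self, Function.update_of_ne hne] at this

theorem Parametrized.extend_src (hP : R.Parametrized S0 S1 β W₀ T E) (hlin : R.Linear)
    (hW₀ : W₀ ∈ R.Cell β) (hT : S0 ⊆ T) (hE : ∀ a ∈ E, R.src a ∈ T ∧ R.tgt a ∈ T) {a : A}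
    (ha : R.IsIdMat a) (hs : R.src a ∉ T) (ht : R.tgt a ∈ T) :
    R.Parametrized S0 S1 β W₀ (insert (R.src a) T) (insert a E) := by
  have hW₀' := (R.mem_cell_iff _ _).1 hW₀
  obtain ⟨e, he⟩ := ha.exists_le_reindex_iff hlin
  have hsub : R.pivots β (R.src a) ⊆ e ⁻¹' R.pivots β (R.tgt a) :=
    (hW₀'.2 _).subset_of_le ((hW₀'.2 _).reindex e) ((he _ _).1 (hW₀'.1 a))
  have haE : a ∉ E := fun h => hs (hE a h).1
  have hne : R.tgt a ≠ R.src a := fun h => hs (h ▸ ht)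
  have hbij := fun y (hy : y ∈ R.admissible S0 S1 β W₀ T E) =>
    bijOn_row_below hsub ((hy.2.1 (R.tgt a)).reindex e)
  refine hP.extend hW₀ hT hE hs (Set.subset_insert a E) hbij fun y hy w => ?_
  refine and_congr_right fun _ => ?_
  rw [← he]
  constructor
  · rintro h a' (rfl | ha') ha'E
    · rwa [Function.update_self, Function.update_of_ne hne]
    · exact absurd ha' ha'E
  · intro h
    have := h a (Set.mem_insert a E) haE
    rwa [Function.update_self, Function.update_of_ne hne] at this

end Rep

section Tree

variable {V0 A : Type} {src tgt : A → V0} {S0 : Set V0} {S1 : Set A}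

theorem IsTreeExtension.exists_crossing (h : IsTreeExtension src tgt S0 S1) {T : Set V0}
    (hT : S0 ⊆ T) {r v : V0} (hr : r ∈ T) (hv : v ∉ T) :
    ∃ a, a ∉ S1 ∧ (src a ∈ T ∧ tgt a ∉ T ∨ src a ∉ T ∧ tgt a ∈ T) := by
  by_contra! hno
  let P : Quot (treeRel S0 (Set.univ : Set V0)) → Prop :=
    Quot.lift (fun x => x.val ∈ T) fun x y hxy =>
      propext (iff_of_true (hT hxy.1) (hT hxy.2))
  have hall : ∀ q, P q := by
    intro q
    induction h.1 (Quot.mk _ ⟨r, trivial⟩) q with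
    | refl => exact hr
    | tail _ hbc ih =>
      obtain ⟨a, -, ha, _, _, ⟨rfl, rfl⟩ | ⟨rfl, rfl⟩⟩ := hbc
      · exact (hno a ha).1 ih
      · by_contra hc
        exact (hno a ha).2 hc ih
  exact hv (hall (Quot.mk _ ⟨v, trivial⟩))

theorem IsTreeExtension.ncard_compl_le [Finite V0] (h : IsTreeExtension src tgt S0 S1) {r : V0}
    (hr : r ∈ S0 ∨ S0 = ∅) : (S1ᶜ).ncard ≤ ((insert r S0)ᶜ).ncard := by
  have hcard := h.2
  have hle : Nat.card (Quot (treeRel S0 (Set.univ : Set V0))) ≤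
      Nat.card (Option ↥(insert r S0)ᶜ) := by
    refine Nat.card_le_card_of_surjective
      (fun o => Quot.mk _ ⟨o.elim r Subtype.val, trivial⟩) ?_
    rintro ⟨⟨v, _⟩⟩
    by_cases hv : v ∈ insert r S0
    · refine ⟨none, ?_⟩
      rcases hv with rfl | hv
      · rfl
      · refine Quot.sound ⟨hr.resolve_right ?_, hv⟩
        rintro rfl
        exact hv
    · exact ⟨some ⟨v, hv⟩, rfl⟩
  rw [Finite.card_option, Nat.card_coe_set_eq, ← hcard] at hle
  refine le_trans (le_of_eq ?_) (Nat.le_of_succ_le_succ hle)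
  rw [← Nat.card_coe_set_eq]
  exact Nat.card_congr (Equiv.subtypeEquivRight fun a => by simp)

theorem IsTreeExtension.nonempty (h : IsTreeExtension src tgt S0 S1) [Finite V0] :
    Nonempty V0 := by
  have h2 := h.2
  have : Nat.card (Quot (treeRel S0 (Set.univ : Set V0))) ≠ 0 := by omega
  obtain ⟨⟨x, _⟩⟩ := (Nat.card_ne_zero.1 this).1
  exact ⟨x⟩

end Tree

namespace Rep

variable {K V0 A B : Type} [Field K] [Fintype B] [LinearOrder B]
  {R : Rep K V0 A B} {S0 : Set V0} {S1 : Set A} {β : Finset B} {W₀ : R.SubRep}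

theorem parametrized_univ [Finite V0] [Finite A] (hlin : R.Linear)
    (htree : IsTreeExtension R.src R.tgt S0 S1) (hid : ∀ a, a ∉ S1 → R.IsIdMat a)
    (hW₀ : W₀ ∈ R.Cell β) : R.Parametrized S0 S1 β W₀ Set.univ S1ᶜ := by
  obtain ⟨r, hr⟩ : ∃ r, r ∈ S0 ∨ S0 = ∅ := by
    rcases S0.eq_empty_or_nonempty with h | ⟨r, hr⟩
    · obtain ⟨r⟩ := htree.nonempty
      exact ⟨r, Or.inr h⟩
    · exact ⟨r, Or.inl hr⟩
  have hbase : R.Parametrized S0 S1 β W₀ (insert r S0) ∅ := by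
    by_cases hrS : r ∈ S0
    · rw [Set.insert_eq_of_mem hrS]
      exact parametrized_base hW₀
    · exact (parametrized_base hW₀).extend_vertex hW₀ le_rfl (fun a ha => ha.elim) hrS
  have hgrow : ∀ n ≤ ((insert r S0)ᶜ).ncard, ∃ (T : Set V0) (E : Set A), insert r S0 ⊆ T ∧
      (∀ a ∈ E, R.src a ∈ T ∧ R.tgt a ∈ T) ∧ E ⊆ S1ᶜ ∧ (T \ insert r S0).ncard = n ∧
      E.ncard = n ∧ R.Parametrized S0 S1 β W₀ T E := by
    intro n
    induction n with
    | zero =>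
      exact fun _ => ⟨_, ∅, le_rfl, fun a ha => ha.elim, Set.empty_subset _, by simp, by simp,
        hbase⟩
    | succ n ih =>
      intro hn
      obtain ⟨T, E, hT, hE, hES, hTn, hEn, hP⟩ := ih (Nat.le_of_succ_le hn)
      have hST : S0 ⊆ T := (Set.subset_insert r S0).trans hT
      obtain ⟨v, hv⟩ : ∃ v, v ∉ T := by
        by_contra! hall
        rw [Set.eq_univ_of_forall hall, ← Set.compl_eq_univ_sdiff] at hTn
        omega
      have hins : ∀ u, u ∉ T → (insert u T \ insert r S0).ncard = n + 1 := by
        intro u hu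
        rw [Set.insert_sdiff_of_notMem _ (fun h => hu (hT h)),
          Set.ncard_insert_of_notMem (fun h => hu h.1), hTn]
      obtain ⟨a, haS, ⟨hs, ht⟩ | ⟨hs, ht⟩⟩ :=
        htree.exists_crossing hST (hT (Set.mem_insert r S0)) hv
      · refine ⟨insert (R.tgt a) T, insert a E, hT.trans (Set.subset_insert _ _), ?_,
          Set.insert_subset haS hES, hins _ ht, ?_,
          hP.extend_tgt hlin hW₀ hST hE (hid a haS) hs ht⟩
        · rintro a' (rfl | ha')
          · exact ⟨Or.inr hs, Or.inl rfl⟩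
          · exact ⟨Or.inr (hE a' ha').1, Or.inr (hE a' ha').2⟩
        · rw [Set.ncard_insert_of_notMem (fun h => ht (hE a h).2), hEn]
      · refine ⟨insert (R.src a) T, insert a E, hT.trans (Set.subset_insert _ _), ?_,
          Set.insert_subset haS hES, hins _ hs, ?_,
          hP.extend_src hlin hW₀ hST hE (hid a haS) hs ht⟩
        · rintro a' (rfl | ha')
          · exact ⟨Or.inl rfl, Or.inr ht⟩
          · exact ⟨Or.inr (hE a' ha').1, Or.inr (hE a' ha').2⟩
        · rw [Set.ncard_insert_of_notMem (fun h => hs (hE a h).1), hEn]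
  obtain ⟨T, E, hT, -, hES, hTn, hEn, hP⟩ := hgrow _ le_rfl
  have hE : E = S1ᶜ :=
    Set.eq_of_subset_of_ncard_le hES (hEn ▸ htree.ncard_compl_le hr) (Set.toFinite _)
  have hTuniv : T = Set.univ := by
    have : T \ insert r S0 = (insert r S0)ᶜ :=
      Set.eq_of_subset_of_ncard_le (fun x hx => hx.2) hTn.ge (Set.toFinite _)
    refine Set.eq_univ_of_forall fun x => ?_
    by_cases hx : x ∈ insert r S0
    · exact hT hx
    · exact (this.ge hx).1
  rwa [hE, hTuniv] at hP

theorem admissible_univ (hsub : ∀ a ∈ S1, R.src a ∈ S0 ∧ R.tgt a ∈ S0) :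
    R.admissible S0 S1 β W₀ Set.univ S1ᶜ = R.Cell β := by
  ext W
  refine Iff.trans ?_ (R.mem_cell_iff β W).symm
  constructor
  · rintro ⟨-, h2, h3, h4⟩
    refine ⟨fun a => ?_, h2⟩
    by_cases ha : a ∈ S1
    · exact h3 a ha (hsub a ha).1 (hsub a ha).2
    · exact h4 a ha
  · rintro ⟨h1, h2⟩
    exact ⟨fun p hp => absurd trivial hp, h2, fun a _ _ _ => h1 a, fun a _ => h1 a⟩

end Rep

end QGr

open QGr in
/-- Let `T` be a tree extension of the subquiver `S = (S0, S1)`, `M` a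
representation of `T` with ordered basis `B` ordered above `S`, and `β ⊆ B` with
`β_S = β ∩ B_S`.  If `C_β^M` is nonempty, then there are `n ≥ 0` and a bijection
`C_β^M ≃ C_{β_S}^{M_S} × K^n` whose first component is the restriction to `S`. -/
theorem schubert_cell_tree_extension_product
    {K V0 A B : Type} [Field K] [Fintype V0] [Fintype A] [Fintype B] [LinearOrder B]
    (R : Rep K V0 A B) (hlin : R.Linear)
    (S0 : Set V0) (S1 : Set A)
    (hsub : ∀ a ∈ S1, R.src a ∈ S0 ∧ R.tgt a ∈ S0)
    (htree : IsTreeExtension R.src R.tgt S0 S1)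
    (hord : R.OrderedAbove S0 S1)
    (β : Finset B) (hne : (R.Cell β).Nonempty) :
    ∃ (n : ℕ)
      (e : ↥(R.Cell β) ≃
        ↥(R.CellOn S0 S1 (β.filter fun b => R.vtx b ∈ S0)) × (Fin n → K)),
      ∀ W : ↥(R.Cell β), ((e W).1 : R.SubRepOn S0) = R.resOn S0 W.val := by
  obtain ⟨W₀, hW₀⟩ := hne
  obtain ⟨ι, _, f, hf⟩ := Rep.parametrized_univ hlin htree hord.2.2.2 hW₀
  rw [Rep.admissible_univ hsub] at hf
  let e := (hf.equiv _).trans (Equiv.Set.prod _ _)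
  let g : ↥(Set.univ : Set (ι → K)) ≃ (Fin (Nat.card ι) → K) :=
    (Equiv.Set.univ _).trans ((Finite.equivFin ι).arrowCongr (Equiv.refl K))
  exact ⟨Nat.card ι, e.trans ((Equiv.refl _).prodCongr g), fun W => rfl⟩
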